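/- (Theorem 1, part 2: asymptotic rate of SUCAG.) Under the SUCAG setup, assume additionally μ ≥ 1, θ⁰ ≠ θ*, and the full delay assumption (A4): (m_k)_{k≥1} is nondecreasing with m_1 ≥ 1, 4 log m_k ≤ c₀ + log k for all k ≥ 1 (for some c₀ ≥ 0), and 2 m_k ≤ m₀ + (1/3 − β) k for all k ≥ 1 (for some m₀ > 0 and β ∈ (0, 1/3)). Fix Δ ∈ (0,1). Then there exists a threshold γ̄ > 0 (depending only on μ, L, L̄_H, c₀, β, m₀, Δ and ‖θ⁰ − θ*‖) such that for every step size γ with 0 < γ ≤ min{γ̄, 2/(μ+L)}, there exists a sequence (V̄(k))_{k≥0} of positive reals with ‖θ^k − θ*‖² ≤ V̄(k) for all k ≥ 0 and lim_{k→∞} V̄(k+1)/V̄(k) = 1 − 2γμL/(μ+L). -/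

import Mathlib

open scoped BigOperators RealInnerProductSpace

section Gradient

variable {E : Type*} [NormedAddCommGroup E] [InnerProductSpace ℝ E] [CompleteSpace E]

theorem le_add_inner_gradient_add_of_lipschitz_gradient {F : E → ℝ} {L : ℝ}
    (hF : Differentiable ℝ F)
    (hL : ∀ x y, ‖gradient F x - gradient F y‖ ≤ L * ‖x - y‖) (x z : E) :
    F z ≤ F x + ⟪gradient F x, z - x⟫ + L / 2 * ‖z - x‖ ^ 2 := by
  set u := z - x with hu
  have hpath : ∀ t : ℝ, HasDerivAt (fun t : ℝ => F (x + t • u)) ⟪gradient F (x + t • u), u⟫ t := by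
    intro t
    have h1 : HasDerivAt (fun t : ℝ => x + t • u) u t := by
      simpa using ((hasDerivAt_id t).smul_const u).const_add x
    have h2 := (hF (x + t • u)).hasGradientAt.hasFDerivAt.comp_hasDerivAt t h1
    exact h2.congr_deriv (by simp)
  have hbound : ∀ t : ℝ, HasDerivAt
      (fun t : ℝ => F x + t * ⟪gradient F x, u⟫ + L / 2 * ‖u‖ ^ 2 * t ^ 2)
      (⟪gradient F x, u⟫ + L * ‖u‖ ^ 2 * t) t := by
    intro t
    have h := (((hasDerivAt_id t).mul_const ⟪gradient F x, u⟫).const_add (F x)).add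
      ((hasDerivAt_pow 2 t).const_mul (L / 2 * ‖u‖ ^ 2))
    refine h.congr_deriv ?_
    norm_num
    ring
  have key := image_le_of_deriv_right_le_deriv_boundary
    (f := fun t : ℝ => F (x + t • u)) (a := 0) (b := 1)
    (fun t _ => (hpath t).continuousAt.continuousWithinAt)
    (fun t _ => (hpath t).hasDerivWithinAt)
    (B := fun t : ℝ => F x + t * ⟪gradient F x, u⟫ + L / 2 * ‖u‖ ^ 2 * t ^ 2)
    (by simp)
    (fun t _ => (hbound t).continuousAt.continuousWithinAt)
    (fun t _ => (hbound t).hasDerivWithinAt)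
    (fun t ht => by
      have h1 : ⟪gradient F (x + t • u) - gradient F x, u⟫ ≤ L * ‖u‖ ^ 2 * t := by
        calc ⟪gradient F (x + t • u) - gradient F x, u⟫
            ≤ ‖gradient F (x + t • u) - gradient F x‖ * ‖u‖ := real_inner_le_norm _ _
          _ ≤ L * ‖x + t • u - x‖ * ‖u‖ := by gcongr; exact hL _ _
          _ = L * ‖u‖ ^ 2 * t := by
            rw [add_sub_cancel_left, norm_smul, Real.norm_of_nonneg ht.1]; ring
      rw [inner_sub_left] at h1
      linarith)
    (Set.right_mem_Icc.2 zero_le_one)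
  simpa [hu] using key

theorem norm_sub_smul_gradient_sub_sq_le {F : E → ℝ} {μ L γ : ℝ} (hμ : 0 < μ) (hLpos : 0 < L)
    (hγ : 0 < γ) (hγ' : γ ≤ 2 / (μ + L)) (hF : Differentiable ℝ F)
    (hL : ∀ x y, ‖gradient F x - gradient F y‖ ≤ L * ‖x - y‖)
    (hsc : ∀ x y : E, F x + ⟪gradient F x, y - x⟫ + μ / 2 * ‖y - x‖ ^ 2 ≤ F y)
    {a : E} (ha : gradient F a = 0) (x : E) :
    ‖x - γ • gradient F x - a‖ ^ 2 ≤ (1 - 2 * γ * μ * L / (μ + L)) * ‖x - a‖ ^ 2 := by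
  have hdesc := le_add_inner_gradient_add_of_lipschitz_gradient hF hL
  set G := gradient F x with hG
  set w := x - a with hw
  set v := G - μ • w with hv
  have hcoer : ∀ t : ℝ, 2 * t * ‖v‖ ^ 2 - (L - μ) * t ^ 2 * ‖v‖ ^ 2 ≤ ⟪v, w⟫ := by
    intro t
    have h1 := hsc a (x - t • v)
    have h2 := hdesc x (x - t • v)
    have h3 := hsc x (a + t • v)
    have h4 := hdesc a (a + t • v)
    have e1 : x - t • v - a = w - t • v := by rw [hw]; abel
    have e2 : x - t • v - x = -(t • v) := by abel
    have e3 : a + t • v - x = -(w - t • v) := by rw [hw]; abel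
    have e4 : a + t • v - a = t • v := by abel
    rw [e1, ha, inner_zero_left] at h1
    rw [e2, ← hG, norm_neg, inner_neg_right, inner_smul_right, norm_smul, mul_pow,
      Real.norm_eq_abs, sq_abs] at h2
    rw [e3, ← hG, norm_neg, inner_neg_right, inner_sub_right, inner_smul_right] at h3
    rw [e4, ha, inner_zero_left, norm_smul, mul_pow, Real.norm_eq_abs, sq_abs] at h4
    have e5 : ‖w - t • v‖ ^ 2 = ‖w‖ ^ 2 - 2 * t * ⟪v, w⟫ + t ^ 2 * ‖v‖ ^ 2 := by
      rw [norm_sub_sq_real, inner_smul_right, norm_smul, mul_pow, Real.norm_eq_abs, sq_abs,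
        real_inner_comm]
      ring
    have e6 : ⟪G, v⟫ = ‖v‖ ^ 2 + μ * ⟪v, w⟫ := by
      have : G = v + μ • w := by rw [hv]; abel
      rw [this, inner_add_left, real_inner_self_eq_norm_sq, inner_smul_left, real_inner_comm]
      simp
    have e7 : ⟪G, w⟫ = ⟪v, w⟫ + μ * ‖w‖ ^ 2 := by
      have : G = v + μ • w := by rw [hv]; abel
      rw [this, inner_add_left, inner_smul_left, real_inner_self_eq_norm_sq]
      simp
    rw [e5] at h1 h3
    rw [e6] at h2 h3
    rw [e7] at h3
    nlinarith
  have hcc : ‖v‖ ^ 2 ≤ (L - μ) * ⟪v, w⟫ := by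
    rcases le_or_gt L μ with hle | hlt
    · have hv0 : ‖v‖ ^ 2 = 0 := by
        by_contra hne
        have hpos : 0 < ‖v‖ ^ 2 := lt_of_le_of_ne (sq_nonneg _) (Ne.symm hne)
        have h := hcoer ((|⟪v, w⟫| + 1) / ‖v‖ ^ 2)
        have h2 : 0 ≤ (μ - L) * ((|⟪v, w⟫| + 1) / ‖v‖ ^ 2) ^ 2 * ‖v‖ ^ 2 :=
          mul_nonneg (mul_nonneg (by linarith) (sq_nonneg _)) hpos.le
        have h3 : (|⟪v, w⟫| + 1) / ‖v‖ ^ 2 * ‖v‖ ^ 2 = |⟪v, w⟫| + 1 :=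
          div_mul_cancel₀ _ hpos.ne'
        nlinarith [le_abs_self ⟪v, w⟫, abs_nonneg ⟪v, w⟫]
      have hv1 : v = 0 := by simpa using hv0
      simp [hv1]
    · have hpos : 0 < L - μ := by linarith
      have h := hcoer (1 / (L - μ))
      have h2 : 2 * (1 / (L - μ)) * ‖v‖ ^ 2 - (L - μ) * (1 / (L - μ)) ^ 2 * ‖v‖ ^ 2
          = ‖v‖ ^ 2 / (L - μ) := by field_simp; ring
      rw [h2, div_le_iff₀ hpos] at h
      linarith
  have ev : ‖v‖ ^ 2 = ‖G‖ ^ 2 - 2 * μ * ⟪G, w⟫ + μ ^ 2 * ‖w‖ ^ 2 := by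
    rw [hv, norm_sub_sq_real, inner_smul_right, norm_smul, mul_pow, Real.norm_eq_abs, sq_abs]
    ring
  have ew : ⟪v, w⟫ = ⟪G, w⟫ - μ * ‖w‖ ^ 2 := by
    rw [hv, inner_sub_left, inner_smul_left, real_inner_self_eq_norm_sq]
    simp
  have hmain : ‖G‖ ^ 2 + μ * L * ‖w‖ ^ 2 ≤ (μ + L) * ⟪G, w⟫ := by
    rw [ev, ew] at hcc
    nlinarith
  have hsum : 0 < μ + L := by linarith
  have e : x - γ • G - a = w - γ • G := by rw [hw]; abel
  rw [e, norm_sub_sq_real, inner_smul_right, norm_smul, mul_pow, Real.norm_eq_abs, sq_abs,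
    real_inner_comm]
  have hγ2 : γ * (μ + L) ≤ 2 := (le_div_iff₀ hsum).1 hγ'
  have h5 : γ ^ 2 * ‖G‖ ^ 2 * (μ + L) ≤ 2 * γ * ‖G‖ ^ 2 := by
    have := mul_le_mul_of_nonneg_right hγ2 (mul_nonneg hγ.le (sq_nonneg ‖G‖))
    nlinarith
  have h6 : (1 - 2 * γ * μ * L / (μ + L)) * ‖w‖ ^ 2
      = ‖w‖ ^ 2 - 2 * γ * (μ * L * ‖w‖ ^ 2) / (μ + L) := by ring
  rw [h6]
  have h7 : 2 * γ * (μ * L * ‖w‖ ^ 2) / (μ + L) ≤ 2 * (γ * ⟪G, w⟫) - γ ^ 2 * ‖G‖ ^ 2 := by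
    rw [div_le_iff₀ hsum]
    nlinarith [mul_le_mul_of_nonneg_left hmain hγ.le]
  linarith

end Gradient

theorem norm_sub_sub_fderiv_le_of_lipschitz_fderiv {E F : Type*} [NormedAddCommGroup E]
    [NormedSpace ℝ E] [NormedAddCommGroup F] [NormedSpace ℝ F] {φ : E → F} {C : ℝ} (hC : 0 ≤ C)
    (hφ : Differentiable ℝ φ)
    (hlip : ∀ x y, ‖fderiv ℝ φ x - fderiv ℝ φ y‖ ≤ C * ‖x - y‖) (x y : E) :
    ‖φ y - (φ x + fderiv ℝ φ x (y - x))‖ ≤ C * ‖y - x‖ ^ 2 := by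
  have h := (convex_segment x y).norm_image_sub_le_of_norm_fderiv_le' (𝕜 := ℝ) (f := φ)
    (φ := fderiv ℝ φ x) (C := C * ‖y - x‖) (fun z _ => hφ z)
    (fun z hz => (hlip z x).trans (by
      gcongr
      exact norm_sub_le_of_mem_segment hz))
    (left_mem_segment ℝ x y) (right_mem_segment ℝ x y)
  rw [← sub_sub]
  calc _ ≤ _ := h
    _ = _ := by ring

theorem pow_mul_one_add_mul_le_one {δ : ℝ} (h0 : 0 ≤ δ) (h1 : δ ≤ 1) (n : ℕ) :
    (1 - δ) ^ n * (1 + n * δ) ≤ 1 := by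
  calc (1 - δ) ^ n * (1 + n * δ) ≤ (1 - δ) ^ n * (1 + δ) ^ n := by
        have := one_add_mul_le_pow (a := δ) (by linarith) n
        have := pow_nonneg (sub_nonneg.2 h1) n
        gcongr
    _ = ((1 - δ) * (1 + δ)) ^ n := (mul_pow _ _ _).symm
    _ ≤ 1 := pow_le_one₀ (mul_nonneg (by linarith) (by linarith)) (by nlinarith)

theorem one_sub_div_eight_pow_ten_lt_sqrt {x : ℝ} (h0 : 0 < x) (h1 : x ≤ 1 / 20) :
    (1 - x / 8) ^ 10 < √(1 - 2 * x) := by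
  have hp : 0 ≤ 1 - x / 8 := by linarith
  refine (Real.lt_sqrt (by positivity)).2 ?_
  have h := pow_mul_one_add_mul_le_one (δ := x / 8) (by linarith) (by linarith) 20
  push_cast at h
  rw [← pow_mul]
  generalize (1 - x / 8) ^ (10 * 2) = q at h ⊢
  by_contra! hcon
  have h2 := mul_le_mul_of_nonneg_right hcon (by linarith : 0 ≤ 1 + 20 * (x / 8))
  nlinarith

theorem pow_delay_le {p : ℝ} {n₀ : ℕ} (hp0 : 0 < p) (hp1 : p ≤ 1) (hpn : 1 / 2 ≤ p ^ (2 * n₀))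
    {t k : ℕ} (h : 5 * k ≤ 6 * t + n₀) : p ^ (12 * t) ≤ 2 * p ^ (10 * k) := by
  have h1 : p ^ (12 * t) * p ^ (2 * n₀) ≤ p ^ (10 * k) := by
    rw [← pow_add]
    exact pow_le_pow_of_le_one hp0.le hp1 (by omega)
  have h2 : 0 < p ^ (12 * t) := pow_pos hp0 _
  nlinarith

section DelayedRecursion

variable {E ι : Type*} [NormedAddCommGroup E]
  {θ : ℕ → E} {a : E} {τ : ℕ → ι → ℕ} {ε : ℕ → ℝ} {p H R : ℝ} {n₀ : ℕ}

theorem delayed_error_le (hp0 : 0 < p) (hp1 : p ≤ 1) (hpn : 1 / 2 ≤ p ^ (2 * n₀))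
    (hτ : ∀ k i, τ k i ≤ k) (hτ5 : ∀ k i, 5 * k ≤ 6 * τ k i + n₀)
    (herr : ∀ k B, (∀ i, ‖θ k - θ (τ k i)‖ ^ 2 ≤ B) → ε k ≤ 2 * H * B)
    {k : ℕ} (hdecay : ∀ j ≤ k, ‖θ j - a‖ ≤ R * p ^ (6 * j)) :
    ε k ≤ 16 * H * R ^ 2 * p ^ (10 * k) := by
  have hR : 0 ≤ R := by simpa using (norm_nonneg _).trans (hdecay 0 k.zero_le)
  refine (herr k (8 * R ^ 2 * p ^ (10 * k)) fun i => ?_).trans_eq (by ring)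
  have h1 : ‖θ k - θ (τ k i)‖ ≤ 2 * R * p ^ (6 * τ k i) := by
    calc ‖θ k - θ (τ k i)‖ = ‖(θ k - a) - (θ (τ k i) - a)‖ := by rw [sub_sub_sub_cancel_right]
      _ ≤ ‖θ k - a‖ + ‖θ (τ k i) - a‖ := norm_sub_le _ _
      _ ≤ R * p ^ (6 * k) + R * p ^ (6 * τ k i) :=
        add_le_add (hdecay k le_rfl) (hdecay _ (hτ k i))
      _ ≤ R * p ^ (6 * τ k i) + R * p ^ (6 * τ k i) := by
        gcongr ?_ + _
        exact mul_le_mul_of_nonneg_left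
          (pow_le_pow_of_le_one hp0.le hp1 (Nat.mul_le_mul_left 6 (hτ k i))) hR
      _ = _ := by ring
  calc ‖θ k - θ (τ k i)‖ ^ 2 ≤ (2 * R * p ^ (6 * τ k i)) ^ 2 := by gcongr
    _ = 4 * R ^ 2 * p ^ (12 * τ k i) := by ring
    _ ≤ 4 * R ^ 2 * (2 * p ^ (10 * k)) := by gcongr; exact pow_delay_le hp0 hp1 hpn (hτ5 k i)
    _ = _ := by ring

theorem norm_sub_le_of_geometric_steps [NormedSpace ℝ E] {g : ℕ → E} {γ G : ℝ} (hγ : 0 ≤ γ)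
    (hG : 0 ≤ G) (hp0 : 0 ≤ p) (hp1 : p ≤ 1) (hstep : ∀ k, θ (k + 1) = θ k - γ • g k) {t k : ℕ}
    (htk : t ≤ k) (hg : ∀ j < k, ‖g j‖ ≤ G * p ^ (6 * j)) :
    ‖θ k - θ t‖ ≤ γ * ((k : ℝ) - t) * G * p ^ (6 * t) := by
  induction k, htk using Nat.le_induction with
  | base => simp
  | succ k htk ih =>
    have h1 : θ (k + 1) - θ t = (θ k - θ t) - γ • g k := by rw [hstep]; abel
    have h2 : ‖g k‖ ≤ G * p ^ (6 * t) := (hg k k.lt_succ_self).trans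
      (mul_le_mul_of_nonneg_left (pow_le_pow_of_le_one hp0 hp1 (by omega)) hG)
    calc ‖θ (k + 1) - θ t‖ ≤ ‖θ k - θ t‖ + ‖γ • g k‖ := by rw [h1]; exact norm_sub_le _ _
      _ ≤ γ * ((k : ℝ) - t) * G * p ^ (6 * t) + γ * (G * p ^ (6 * t)) := by
        rw [norm_smul, Real.norm_of_nonneg hγ]
        gcongr
        exact ih fun j hj => hg j (by omega)
      _ = _ := by push_cast; ring

theorem delayed_recursion_decay [NormedSpace ℝ E] {g : ℕ → E} {γ κ L K : ℝ} (hγ : 0 < γ)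
    (hκ : 0 < κ) (hH : 0 ≤ H) (hL : 0 ≤ L) (hK : 0 ≤ K) (hR : 0 < R)
    (hp : p = 1 - γ * κ / 8) (hsmall : γ * κ * (n₀ + 1) ≤ 1)
    (hsmall' : 4 * (32 * H * K * (L * R + 16 * H * R ^ 2) ^ 2 / κ) * γ ≤ κ * R)
    (hstep : ∀ k, θ (k + 1) = θ k - γ • g k)
    (hcontr : ∀ k, ‖θ (k + 1) - a‖ ≤ (1 - γ * κ) * ‖θ k - a‖ + γ * ε k)
    (hg : ∀ k, ‖g k‖ ≤ L * ‖θ k - a‖ + ε k)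
    (hτ : ∀ k i, τ k i ≤ k) (hτ5 : ∀ k i, 5 * k ≤ 6 * τ k i + n₀)
    (hτK : ∀ (k : ℕ) i, ((k : ℝ) - τ k i) ^ 2 ≤ K * k)
    (herr : ∀ k B, (∀ i, ‖θ k - θ (τ k i)‖ ^ 2 ≤ B) → ε k ≤ 2 * H * B)
    (hinit : ‖θ 0 - a‖ ≤ R) :
    (0 < p ∧ p ≤ 1 ∧ 1 / 2 ≤ p ^ (2 * n₀)) ∧ ∀ k, ‖θ k - a‖ ≤ R * p ^ (6 * k) := by
  have hx : 0 < γ * κ := mul_pos hγ hκ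
  have hx1 : γ * κ ≤ 1 := by
    have : 0 ≤ γ * κ * n₀ := by positivity
    linarith
  have hp0 : 0 < p := by rw [hp]; linarith
  have hp1 : p ≤ 1 := by rw [hp]; linarith
  have hpow : ∀ n : ℕ, 1 - n * (γ * κ / 8) ≤ p ^ n := by
    intro n
    have h := one_add_mul_le_pow (a := -(γ * κ / 8)) (by linarith) n
    rw [hp, sub_eq_add_neg 1 (γ * κ / 8)]
    linarith
  have hpn : 1 / 2 ≤ p ^ (2 * n₀) := by
    have h := hpow (2 * n₀)
    push_cast at h
    nlinarith
  refine ⟨⟨hp0, hp1, hpn⟩, fun k => ?_⟩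
  set G := L * R + 16 * H * R ^ 2 with hG
  have hG0 : 0 ≤ G := by positivity
  induction k using Nat.strong_induction_on with
  | _ k ih =>
  rcases k with _ | k
  · simpa using hinit
  have hdecay : ∀ j ≤ k, ‖θ j - a‖ ≤ R * p ^ (6 * j) := fun j hj => ih j (by omega)
  have hgj : ∀ j < k, ‖g j‖ ≤ G * p ^ (6 * j) := by
    intro j hj
    have h1 := delayed_error_le (a := a) hp0 hp1 hpn hτ hτ5 herr (k := j)
      fun l hl => hdecay l (by omega)
    have h2 : p ^ (10 * j) ≤ p ^ (6 * j) := pow_le_pow_of_le_one hp0.le hp1 (by omega)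
    calc ‖g j‖ ≤ L * (R * p ^ (6 * j)) + 16 * H * R ^ 2 * p ^ (6 * j) :=
          (hg j).trans (add_le_add (mul_le_mul_of_nonneg_left (hdecay j hj.le) hL)
            (h1.trans (mul_le_mul_of_nonneg_left h2 (by positivity))))
      _ = _ := by rw [hG]; ring
  have hkp : (k : ℝ) * p ^ (4 * k) ≤ 8 / (γ * κ) := by
    have h1 : p ^ (4 * k) ≤ p ^ k := pow_le_pow_of_le_one hp0.le hp1 (by omega)
    have h2 := pow_mul_one_add_mul_le_one (δ := γ * κ / 8) (by linarith) (by linarith) k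
    rw [← hp] at h2
    have h3 : (k : ℝ) * p ^ (4 * k) ≤ k * p ^ k := by gcongr
    have h4 : 0 ≤ p ^ k := by positivity
    rw [le_div_iff₀ hx]
    nlinarith
  have hε : ε k ≤ 2 * H * (16 * γ * K * G ^ 2 / κ * p ^ (6 * k)) := by
    refine herr k _ fun i => ?_
    have h1 := norm_sub_le_of_geometric_steps hγ.le hG0 hp0.le hp1 hstep (hτ k i) hgj
    calc ‖θ k - θ (τ k i)‖ ^ 2 ≤ (γ * ((k : ℝ) - τ k i) * G * p ^ (6 * τ k i)) ^ 2 := by gcongr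
      _ = γ ^ 2 * G ^ 2 * (((k : ℝ) - τ k i) ^ 2 * p ^ (12 * τ k i)) := by ring
      _ ≤ γ ^ 2 * G ^ 2 * ((K * k) * (2 * p ^ (10 * k))) := by
        gcongr
        · exact hτK k i
        · exact pow_delay_le hp0 hp1 hpn (hτ5 k i)
      _ = γ ^ 2 * G ^ 2 * K * 2 * p ^ (6 * k) * (k * p ^ (4 * k)) := by ring
      _ ≤ γ ^ 2 * G ^ 2 * K * 2 * p ^ (6 * k) * (8 / (γ * κ)) := by gcongr
      _ = _ := by field_simp; ring
  have h6 : 1 - 3 / 4 * (γ * κ) ≤ p ^ 6 := by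
    have h := hpow 6
    push_cast at h
    linarith
  have hq : 0 ≤ p ^ (6 * k) := by positivity
  calc ‖θ (k + 1) - a‖
      ≤ (1 - γ * κ) * (R * p ^ (6 * k))
        + γ * (2 * H * (16 * γ * K * G ^ 2 / κ * p ^ (6 * k))) := by
        refine (hcontr k).trans (add_le_add ?_ (mul_le_mul_of_nonneg_left hε hγ.le))
        exact mul_le_mul_of_nonneg_left (hdecay k le_rfl) (by linarith)
    _ = ((1 - γ * κ) * R + γ * (4 * (32 * H * K * G ^ 2 / κ) * γ) / 4) * p ^ (6 * k) := by ring
    _ ≤ ((1 - γ * κ) * R + γ * (κ * R) / 4) * p ^ (6 * k) := by gcongr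
    _ = R * (1 - 3 / 4 * (γ * κ)) * p ^ (6 * k) := by ring
    _ ≤ R * p ^ 6 * p ^ (6 * k) := by gcongr
    _ = _ := by ring

end DelayedRecursion

/-- A linear recursion perturbed by a geometric error of smaller ratio decays at the rate of its
unperturbed part. -/
theorem exists_geometric_bound_of_perturbed {r : ℕ → ℝ} {s q C : ℝ} (hs : 0 < s) (hq : 0 ≤ q)
    (hqs : q < s) (hC : 0 ≤ C) (hr : ∀ k, r (k + 1) ≤ s * r k + C * q ^ k) :
    ∃ A > 0, ∀ k, r k ≤ A * s ^ k := by
  have hsq : 0 < s - q := by linarith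
  refine ⟨|r 0| + C / (s - q) + 1, by positivity, fun k => ?_⟩
  have h : r k ≤ (|r 0| + C / (s - q) + 1) * s ^ k - C / (s - q) * q ^ k := by
    induction k with
    | zero => simp; linarith [le_abs_self (r 0)]
    | succ k ih =>
      have e : C * q ^ k = C / (s - q) * (s - q) * q ^ k := by field_simp
      calc r (k + 1) ≤ s * r k + C * q ^ k := hr k
        _ ≤ s * ((|r 0| + C / (s - q) + 1) * s ^ k - C / (s - q) * q ^ k) + C * q ^ k := by gcongr
        _ = _ := by rw [e]; ring
  have : 0 ≤ C / (s - q) * q ^ k := by positivity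
  linarith

theorem hasGradientAt_average {E ι : Type*} [NormedAddCommGroup E] [InnerProductSpace ℝ E]
    [CompleteSpace E] [Fintype ι] {f : ι → E → ℝ} (hf : ∀ i, Differentiable ℝ (f i)) (c : ℝ)
    (x : E) :
    HasGradientAt (fun y => c * ∑ i, f i y) (c • ∑ i, gradient (f i) x) x := by
  rw [hasGradientAt_iff_hasFDerivAt, map_smul, map_sum]
  exact (HasFDerivAt.fun_sum fun i _ => (hf i x).hasGradientAt.hasFDerivAt).const_mul c

theorem differentiable_gradient {E : Type*} [NormedAddCommGroup E] [InnerProductSpace ℝ E]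
    [CompleteSpace E] {f : E → ℝ} (hf : ContDiff ℝ 2 f) : Differentiable ℝ (gradient f) := by
  have h : ContDiff ℝ 1 (fderiv ℝ f) := hf.fderiv_right (by norm_num)
  exact (InnerProductSpace.toDual ℝ E).symm.toContinuousLinearEquiv.differentiable.comp
    (h.differentiable (by norm_num))

theorem gradient_eq_zero_of_forall_le {E : Type*} [NormedAddCommGroup E] [InnerProductSpace ℝ E]
    [CompleteSpace E] {f : E → ℝ} {a : E} (h : ∀ x, f a ≤ f x) : gradient f a = 0 := by
  have : IsLocalMin f a := Filter.Eventually.of_forall h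
  simp [gradient, this.fderiv_eq_zero]

/-- The deviation of a curvature-aided aggregated gradient from the full gradient: if every
surrogate is within `C` of the corresponding component, the deviation is at most `2 * C`. -/
theorem norm_aggregated_sub_average_le {E ι : Type*} [NormedAddCommGroup E] [NormedSpace ℝ E]
    [Fintype ι] [Nonempty ι] {u v : ι → E} {C : ℝ} (h : ∀ i, ‖u i - v i‖ ≤ C) (j : ι) :
    ‖(u j - v j + (Fintype.card ι : ℝ)⁻¹ • ∑ i, v i) - (Fintype.card ι : ℝ)⁻¹ • ∑ i, u i‖
      ≤ 2 * C := by
  have hcard : (0 : ℝ) < Fintype.card ι := by exact_mod_cast Fintype.card_pos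
  have e : (u j - v j + (Fintype.card ι : ℝ)⁻¹ • ∑ i, v i) - (Fintype.card ι : ℝ)⁻¹ • ∑ i, u i
      = (u j - v j) - (Fintype.card ι : ℝ)⁻¹ • ∑ i, (u i - v i) := by
    rw [Finset.sum_sub_distrib, smul_sub]; abel
  have h1 : ‖∑ i, (u i - v i)‖ ≤ Fintype.card ι * C := by
    calc ‖∑ i, (u i - v i)‖ ≤ ∑ _i : ι, C := norm_sum_le_of_le _ fun i _ => h i
      _ = _ := by simp
  have h2 : ‖(Fintype.card ι : ℝ)⁻¹ • ∑ i, (u i - v i)‖ ≤ C := by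
    rw [norm_smul, Real.norm_of_nonneg (by positivity), inv_mul_le_iff₀ hcard]
    exact h1
  rw [e]
  linarith [norm_sub_le (u j - v j) ((Fintype.card ι : ℝ)⁻¹ • ∑ i, (u i - v i)), h j]

theorem sq_le_exp_mul_of_four_mul_log_le {x c y : ℝ} {k : ℕ} (hk : 1 ≤ k) (hx : 1 ≤ x)
    (hy0 : 0 ≤ y) (hy : y ≤ x) (h : 4 * Real.log x ≤ c + Real.log k) :
    y ^ 2 ≤ Real.exp c * k := by
  have hk0 : (0 : ℝ) < k := by exact_mod_cast hk
  have h1 : x ^ 4 ≤ Real.exp c * k := by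
    rw [← Real.log_le_log_iff (by positivity) (by positivity), Real.log_pow,
      Real.log_mul (Real.exp_pos c).ne' hk0.ne', Real.log_exp]
    exact_mod_cast h
  calc y ^ 2 ≤ x ^ 2 := by gcongr
    _ ≤ x ^ 4 := pow_le_pow_right₀ hx (by norm_num)
    _ ≤ _ := h1

/-- Theorem 1, part 2: asymptotic rate of SUCAG. The threshold
`γ̄` depends only on `μ, L, L̄_H, c₀, β, m₀, Δ` and `R₀ = ‖θ⁰ − θ*‖`, since it is
quantified before all other data. -/
theorem sucag_asymptotic_rate
    (μ L LbarH c₀ β m₀ Δ R₀ : ℝ)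
    (hμ : 1 ≤ μ) (hL : 0 < L) (hLbarH : 0 < LbarH)
    (hc₀ : 0 ≤ c₀) (hβ0 : 0 < β) (hβ : β < 1 / 3) (hm₀ : 0 < m₀)
    (hΔ0 : 0 < Δ) (hΔ1 : Δ < 1) (hR₀ : 0 < R₀) :
    ∃ γbar : ℝ, 0 < γbar ∧
      ∀ (d N : ℕ), 1 ≤ d → 1 ≤ N →
      ∀ (f : Fin N → EuclideanSpace ℝ (Fin d) → ℝ),
      (∀ i, ConvexOn ℝ Set.univ (f i)) →
      (∀ i, ContDiff ℝ 2 (f i)) →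
      ∀ (LH : Fin N → ℝ), (∀ i, 0 < LH i) →
      (∀ i x y, ‖fderiv ℝ (gradient (f i)) x - fderiv ℝ (gradient (f i)) y‖
        ≤ LH i * ‖x - y‖) →
      IsGreatest (Set.range LH) LbarH →
      ∀ (F : EuclideanSpace ℝ (Fin d) → ℝ),
      F = (fun x => (N : ℝ)⁻¹ * ∑ i, f i x) →
      (∀ x y, ‖gradient F x - gradient F y‖ ≤ L * ‖x - y‖) →
      (∀ x y : EuclideanSpace ℝ (Fin d),
        F x + ⟪gradient F x, y - x⟫ + μ / 2 * ‖y - x‖ ^ 2 ≤ F y) →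
      ∀ (θstar : EuclideanSpace ℝ (Fin d)), (∀ x, F θstar ≤ F x) →
      -- the delay assumption (A4)
      ∀ (m : ℕ → ℝ), 1 ≤ m 1 →
      (∀ j l : ℕ, 1 ≤ j → j ≤ l → m j ≤ m l) →
      (∀ k : ℕ, 1 ≤ k → 4 * Real.log (m k) ≤ c₀ + Real.log k) →
      (∀ k : ℕ, 1 ≤ k → 2 * m k ≤ m₀ + (1 / 3 - β) * k) →
      -- the step size
      ∀ (γ : ℝ), 0 < γ → γ ≤ γbar → γ ≤ 2 / (μ + L) →
      -- the SUCAG iterates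
      ∀ (idx : ℕ → Fin N) (τ : ℕ → Fin N → ℕ),
      (∀ (k : ℕ) (i : Fin N), τ k i ≤ k - 1) →
      (∀ k : ℕ, 1 ≤ k → ∀ i, (k : ℝ) - (τ k i : ℝ) ≤ m k) →
      ∀ (θ : ℕ → EuclideanSpace ℝ (Fin d))
        (gA : Fin N → ℕ → EuclideanSpace ℝ (Fin d) → EuclideanSpace ℝ (Fin d)),
      (∀ i k x, gA i k x = gradient (f i) (θ (τ k i))
        + (fderiv ℝ (gradient (f i)) (θ (τ k i))) (x - θ (τ k i))) →
      ∀ (g : ℕ → EuclideanSpace ℝ (Fin d)),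
      (∀ k, g k = (gradient (f (idx k)) (θ k) - gA (idx k) k (θ k))
        + (N : ℝ)⁻¹ • ∑ i, gA i k (θ k)) →
      (∀ k, θ (k + 1) = θ k - γ • g k) →
      -- the initialization
      ‖θ 0 - θstar‖ = R₀ →
      -- conclusion: an upper bound sequence with asymptotic ratio 1 − 2γμL/(μ+L)
      ∃ V : ℕ → ℝ, (∀ k, 0 < V k) ∧ (∀ k, ‖θ k - θstar‖ ^ 2 ≤ V k) ∧
        Filter.Tendsto (fun k => V (k + 1) / V k) Filter.atTop
          (nhds (1 - 2 * γ * μ * L / (μ + L))) := by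
  set κ := μ * L / (μ + L) with hκdef
  have hκ : 0 < κ := by positivity
  set n₀ := ⌈3 * m₀⌉₊
  set C₁ := 32 * LbarH * Real.exp c₀ * (L * R₀ + 16 * LbarH * R₀ ^ 2) ^ 2 / κ
  have hC₁0 : 0 < C₁ := by positivity
  have hD : 0 < 20 * κ + κ * (n₀ + 1) + 4 * C₁ / (κ * R₀) := by positivity
  refine ⟨1 / (20 * κ + κ * (n₀ + 1) + 4 * C₁ / (κ * R₀)), by positivity, ?_⟩
  intro d N _ hN f _ hf LH _ hLH hmax F hF hFL hFsc a ha m hm1 hmono hmlog hmlin γ hγ hγbar hγ2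
    idx τ hτ hτm θ gA hgA g hg hstep hinit
  have hγD := (le_div_iff₀ hD).1 hγbar
  have hκn : 0 ≤ γ * (κ * (n₀ + 1)) := by positivity
  have hκC : 0 ≤ γ * (4 * C₁ / (κ * R₀)) := by positivity
  have hγκ : 0 < γ * κ := by positivity
  have hx : γ * κ ≤ 1 / 20 := by linarith
  have hsmall : γ * κ * (n₀ + 1) ≤ 1 := by linarith
  have hsmall' : 4 * C₁ * γ ≤ κ * R₀ := by
    have h : γ * (4 * C₁) / (κ * R₀) ≤ 1 := by rw [mul_div_assoc]; linarith
    rw [div_le_one (by positivity)] at h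
    linarith
  have hρ : 1 - 2 * γ * μ * L / (μ + L) = 1 - 2 * (γ * κ) := by rw [hκdef]; ring
  set s := √(1 - 2 * (γ * κ))
  have hs0 : 0 < s := Real.sqrt_pos.2 (by linarith)
  have hssq : s ^ 2 = 1 - 2 * (γ * κ) := Real.sq_sqrt (by linarith)
  have hs1 : s ≤ 1 - γ * κ := Real.sqrt_le_iff.2 ⟨by linarith, by nlinarith⟩
  have hgradF : ∀ x, HasGradientAt F ((N : ℝ)⁻¹ • ∑ i, gradient (f i) x) x := by
    rw [hF]
    exact hasGradientAt_average (fun i => (hf i).differentiable (by norm_num)) _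
  have hFdiff : Differentiable ℝ F := fun x => (hgradF x).differentiableAt
  have hgrada : gradient F a = 0 := gradient_eq_zero_of_forall_le ha
  have : Nonempty (Fin N) := ⟨⟨0, hN⟩⟩
  have htaylor : ∀ k i, ‖gradient (f i) (θ k) - gA i k (θ k)‖
      ≤ LbarH * ‖θ k - θ (τ k i)‖ ^ 2 := by
    intro k i
    rw [hgA]
    exact norm_sub_sub_fderiv_le_of_lipschitz_fderiv hLbarH.le (differentiable_gradient (hf i))
      (fun x y => (hLH i x y).trans (mul_le_mul_of_nonneg_right
        (hmax.2 (Set.mem_range_self i)) (norm_nonneg _))) _ _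
  have herr : ∀ k B, (∀ i, ‖θ k - θ (τ k i)‖ ^ 2 ≤ B) →
      ‖g k - gradient F (θ k)‖ ≤ 2 * LbarH * B := by
    intro k B hB
    have h := norm_aggregated_sub_average_le (C := LbarH * B)
      (fun i => (htaylor k i).trans (mul_le_mul_of_nonneg_left (hB i) hLbarH.le)) (idx k)
    rw [Fintype.card_fin, ← hg, ← (hgradF (θ k)).gradient] at h
    linarith
  have hcontr : ∀ k, ‖θ (k + 1) - a‖ ≤ s * ‖θ k - a‖ + γ * ‖g k - gradient F (θ k)‖ := by
    intro k
    have h := norm_sub_smul_gradient_sub_sq_le (by linarith) hL hγ hγ2 hFdiff hFL hFsc hgrada (θ k)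
    rw [hρ, ← hssq, ← mul_pow] at h
    have h1 := le_of_sq_le_sq h (by positivity)
    have e : θ (k + 1) - a
        = (θ k - γ • gradient F (θ k) - a) - γ • (g k - gradient F (θ k)) := by
      rw [hstep, smul_sub]; abel
    calc ‖θ (k + 1) - a‖
        ≤ ‖θ k - γ • gradient F (θ k) - a‖ + ‖γ • (g k - gradient F (θ k))‖ := by
          rw [e]; exact norm_sub_le _ _
      _ ≤ _ := by rw [norm_smul, Real.norm_of_nonneg hγ.le]; gcongr
  have hgbound : ∀ k, ‖g k‖ ≤ L * ‖θ k - a‖ + ‖g k - gradient F (θ k)‖ := by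
    intro k
    have h := hFL (θ k) a
    rw [hgrada, sub_zero] at h
    linarith [norm_le_norm_add_norm_sub' (g k) (gradient F (θ k))]
  have hτk : ∀ k i, τ k i ≤ k := fun k i => (hτ k i).trans (Nat.sub_le k 1)
  have hτ5 : ∀ k i, 5 * k ≤ 6 * τ k i + n₀ := by
    intro k i
    rcases Nat.eq_zero_or_pos k with rfl | hk
    · omega
    have h1 := hτm k hk i
    have h2 := hmlin k hk
    have h3 : 3 * m₀ ≤ n₀ := Nat.le_ceil _
    have h4 : 0 ≤ β * k := by positivity
    have h5 : (5 * k : ℝ) ≤ 6 * τ k i + n₀ := by linarith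
    exact_mod_cast h5
  have hτK : ∀ (k : ℕ) i, ((k : ℝ) - τ k i) ^ 2 ≤ Real.exp c₀ * k := by
    intro k i
    rcases Nat.eq_zero_or_pos k with rfl | hk
    · simp [Nat.le_zero.1 (hτk 0 i)]
    have h1 : (τ k i : ℝ) ≤ k := by exact_mod_cast hτk k i
    exact sq_le_exp_mul_of_four_mul_log_le hk (hm1.trans (hmono 1 k le_rfl hk)) (by linarith)
      (hτm k hk i) (hmlog k hk)
  set p := 1 - γ * κ / 8 with hp
  obtain ⟨⟨hp0, hp1, hpn⟩, hdecay⟩ := delayed_recursion_decay hγ hκ hLbarH.le hL.le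
    (Real.exp_pos c₀).le hR₀ hp hsmall hsmall' hstep
    (fun k => (hcontr k).trans (by gcongr)) hgbound hτk hτ5 hτK herr hinit.le
  have hps : p ^ 10 < s := one_sub_div_eight_pow_ten_lt_sqrt hγκ hx
  obtain ⟨A, hA, hbound⟩ := exists_geometric_bound_of_perturbed (r := fun k => ‖θ k - a‖) hs0
    (pow_nonneg hp0.le 10) hps (C := γ * (16 * LbarH * R₀ ^ 2)) (by positivity) (fun k => by
      have h := delayed_error_le hp0 hp1 hpn hτk hτ5 herr (k := k) fun j _ => hdecay j
      rw [← pow_mul, mul_assoc γ]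
      exact (hcontr k).trans (by gcongr))
  refine ⟨fun k => (A * s ^ k) ^ 2, fun k => by positivity, fun k => ?_, ?_⟩
  · have := hbound k
    dsimp only at this ⊢
    gcongr
  · refine tendsto_const_nhds.congr fun k => ?_
    rw [hρ, ← hssq]
    field_simp
    ring
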